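/- arXiv:2205.12359 — 7 statements merged into one kernel-verified Lean document; each statement's English description precedes it below -/
import Mathlib

section
/- Let B be the γ-incidence matrix of a mixed graph (G, H). Then B ⬝ Bᴴ = D + H, i.e. for every vertex u the (u,u) entry of B ⬝ Bᴴ equals the degree of u in G, and for all distinct vertices u, v the (u,v) entry of B ⬝ Bᴴ equals H u v. -/
open Matrix Complex BigOperators

noncomputable def gamma : ℂ := Complex.exp (2 * Real.pi * Complex.I / 3)

theorem norm_gamma : ‖gamma‖ = 1 := by
  have h : (2 * Real.pi * Complex.I / 3 : ℂ) = ((2 * Real.pi / 3 : ℝ) : ℂ) * Complex.I := by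
    push_cast
    ring
  rw [gamma, h, Complex.norm_exp_ofReal_mul_I]

theorem mul_star_eq_one_of_mem {z : ℂ} (hz : z ∈ ({1, gamma, gamma ^ 2} : Set ℂ)) :
    z * star z = 1 := by
  have h : ‖z‖ = 1 := by
    rcases hz with rfl | rfl | rfl <;> simp [norm_gamma]
  have := Complex.mul_conj' z
  rw [h] at this
  simpa using this

theorem SimpleGraph.card_filter_mem_edgeSet {V : Type*} [Fintype V] [DecidableEq V]
    (G : SimpleGraph V) [DecidableRel G.Adj] (u : V) :
    (Finset.univ.filter fun e : G.edgeSet => u ∈ (e : Sym2 V)).card = G.degree u := by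
  rw [← G.card_incidenceFinset_eq_degree, ← Finset.card_map (Function.Embedding.subtype _)]
  congr 1
  ext e
  simp [SimpleGraph.incidenceSet, and_comm]

/-- If `B` is a γ-incidence matrix of a mixed graph `(G, H)`, then `B ⬝ Bᴴ = D + H`:
the `(u,u)` entry is the degree of `u` and for `u ≠ v` the `(u,v)` entry is `H u v`. -/
theorem incidence_mul_conjTranspose {V : Type*} [Fintype V] [DecidableEq V] [Nonempty V]
    (G : SimpleGraph V) [DecidableRel G.Adj]
    (H : Matrix V V ℂ) (hH : H.IsHermitian)
    (hadj : ∀ u v, G.Adj u v → H u v ∈ ({1, gamma, gamma ^ 2} : Set ℂ))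
    (hnadj : ∀ u v, ¬ G.Adj u v → H u v = 0)
    (B : Matrix V G.edgeSet ℂ)
    (hB : ∀ (e : G.edgeSet) (u v : V), (e : Sym2 V) = s(u, v) →
      B u e ∈ ({1, gamma, gamma ^ 2} : Set ℂ) ∧ B u e * star (B v e) = H u v)
    (hB0 : ∀ (e : G.edgeSet) (w : V), w ∉ (e : Sym2 V) → B w e = 0) :
    (∀ u, (B * Bᴴ) u u = (G.degree u : ℂ)) ∧
    (∀ u v, u ≠ v → (B * Bᴴ) u v = H u v) := by
  refine ⟨fun u => ?_, fun u v huv => ?_⟩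
  · have h : ∀ e : G.edgeSet, B u e * star (B u e) = if u ∈ (e : Sym2 V) then 1 else 0 := by
      intro e
      split_ifs with he
      · obtain ⟨w, hw⟩ := he
        exact mul_star_eq_one_of_mem (hB e u w hw).1
      · simp [hB0 e u he]
    simp only [Matrix.mul_apply, Matrix.conjTranspose_apply, h, Finset.sum_boole,
      G.card_filter_mem_edgeSet]
  · have hzero : ∀ e : G.edgeSet, (e : Sym2 V) ≠ s(u, v) → B u e * star (B v e) = 0 := by
      intro e he
      by_cases hu : u ∈ (e : Sym2 V)
      · have hv : v ∉ (e : Sym2 V) := fun hv => he ((Sym2.mem_and_mem_iff huv).1 ⟨hu, hv⟩)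
        simp [hB0 e v hv]
      · simp [hB0 e u hu]
    simp only [Matrix.mul_apply, Matrix.conjTranspose_apply]
    by_cases huv' : G.Adj u v
    · rw [Fintype.sum_eq_single ⟨s(u, v), huv'⟩
        fun e he => hzero e fun h => he (Subtype.ext h)]
      exact (hB _ u v rfl).2
    · rw [hnadj u v huv']
      refine Finset.sum_eq_zero fun e _ => hzero e fun h => huv' ?_
      have := e.2
      rwa [h] at this
end

section
/- Let B be the γ-incidence matrix of a mixed graph (G, H). Then every diagonal entry of Bᴴ ⬝ B equals 2; moreover, for distinct edges e and f of G, the (e,f) entry of Bᴴ ⬝ B lies in {1, γ, γ²} if e and f share a vertex, and equals 0 if e and f are disjoint. Consequently Bᴴ ⬝ B − 2·I is the γ-Hermitian adjacency matrix of a mixed graph whose underlying simple graph is the line graph of G. -/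
open Matrix Complex BigOperators

theorem isPrimitiveRoot_gamma : IsPrimitiveRoot gamma 3 := by
  simpa [gamma] using Complex.isPrimitiveRoot_exp 3 three_ne_zero

theorem mem_powers_gamma_iff {z : ℂ} : z ∈ ({1, gamma, gamma ^ 2} : Set ℂ) ↔ z ^ 3 = 1 := by
  have hg := isPrimitiveRoot_gamma.pow_eq_one
  constructor
  · rintro (rfl | rfl | rfl)
    · simp
    · exact hg
    · rw [← pow_mul, mul_comm, pow_mul, hg, one_pow]
  · intro h
    obtain ⟨i, hi, rfl⟩ := isPrimitiveRoot_gamma.eq_pow_of_pow_eq_one h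
    interval_cases i <;> simp

theorem star_mul_self_of_pow_three_eq_one {z : ℂ} (h : z ^ 3 = 1) : star z * z = 1 := by
  have hz : ‖z‖ = 1 := norm_eq_one_of_pow_eq_one h three_ne_zero
  rw [Complex.star_def, Complex.conj_mul', hz]
  simp

/-- Distinct elements of `Sym2 V` have at most one common member. -/
theorem Sym2.eq_of_mem_of_mem_of_ne {V : Type*} {e f : Sym2 V} (hef : e ≠ f) {v w : V}
    (hve : v ∈ e) (hvf : v ∈ f) (hwe : w ∈ e) (hwf : w ∈ f) : w = v := by
  by_contra hwv
  exact hef (((Sym2.mem_and_mem_iff hwv).1 ⟨hwe, hve⟩).trans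
    ((Sym2.mem_and_mem_iff hwv).1 ⟨hwf, hvf⟩).symm)

/-- If `B` is a γ-incidence matrix of a mixed graph `(G, H)`, then `Bᴴ ⬝ B` has all diagonal
entries equal to `2`, its `(e,f)` entry for distinct edges `e, f` lies in `{1, γ, γ²}` when
`e` and `f` share a vertex and is `0` otherwise; hence `Bᴴ ⬝ B − 2·I` is the γ-Hermitian
adjacency matrix of a mixed graph whose underlying simple graph is the line graph of `G`. -/
theorem conjTranspose_mul_incidence {V : Type*} [Fintype V] [DecidableEq V] [Nonempty V]
    (G : SimpleGraph V) [DecidableRel G.Adj]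
    (H : Matrix V V ℂ) (hH : H.IsHermitian)
    (hadj : ∀ u v, G.Adj u v → H u v ∈ ({1, gamma, gamma ^ 2} : Set ℂ))
    (hnadj : ∀ u v, ¬ G.Adj u v → H u v = 0)
    (B : Matrix V G.edgeSet ℂ)
    (hB : ∀ (e : G.edgeSet) (u v : V), (e : Sym2 V) = s(u, v) →
      B u e ∈ ({1, gamma, gamma ^ 2} : Set ℂ) ∧ B u e * star (B v e) = H u v)
    (hB0 : ∀ (e : G.edgeSet) (w : V), w ∉ (e : Sym2 V) → B w e = 0) :
    (∀ e : G.edgeSet, (Bᴴ * B) e e = 2) ∧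
    (∀ e f : G.edgeSet, e ≠ f →
      ((∃ v : V, v ∈ (e : Sym2 V) ∧ v ∈ (f : Sym2 V)) →
        (Bᴴ * B) e f ∈ ({1, gamma, gamma ^ 2} : Set ℂ)) ∧
      ((¬ ∃ v : V, v ∈ (e : Sym2 V) ∧ v ∈ (f : Sym2 V)) → (Bᴴ * B) e f = 0)) ∧
    (∀ M : Matrix G.edgeSet G.edgeSet ℂ, M = Bᴴ * B - 2 • (1 : Matrix G.edgeSet G.edgeSet ℂ) →
      M.IsHermitian ∧
      (∀ e f : G.edgeSet, G.lineGraph.Adj e f → M e f ∈ ({1, gamma, gamma ^ 2} : Set ℂ)) ∧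
      (∀ e f : G.edgeSet, ¬ G.lineGraph.Adj e f → M e f = 0)) := by
  have hcube : ∀ (e : G.edgeSet) (u : V), u ∈ (e : Sym2 V) → B u e ^ 3 = 1 := by
    intro e u hu
    obtain ⟨v, hv⟩ := Sym2.mem_iff_exists.1 hu
    exact mem_powers_gamma_iff.1 (hB e u v hv).1
  have hterm : ∀ (e f : G.edgeSet) (w : V), ¬ (w ∈ (e : Sym2 V) ∧ w ∈ (f : Sym2 V)) →
      Bᴴ e w * B w f = 0 := by
    intro e f w hw
    by_cases he : w ∈ (e : Sym2 V)
    · rw [hB0 f w fun hf => hw ⟨he, hf⟩, mul_zero]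
    · rw [conjTranspose_apply, hB0 e w he, star_zero, zero_mul]
  have hdiag : ∀ e : G.edgeSet, (Bᴴ * B) e e = 2 := by
    rintro ⟨e, he⟩
    induction e using Sym2.ind with | _ u v =>
    have huv : u ≠ v := G.ne_of_adj he
    rw [mul_apply, Fintype.sum_eq_add u v huv fun w hw => hterm _ _ w (by simpa using hw),
      conjTranspose_apply, conjTranspose_apply,
      star_mul_self_of_pow_three_eq_one (hcube _ _ (Sym2.mem_mk_left u v)),
      star_mul_self_of_pow_three_eq_one (hcube _ _ (Sym2.mem_mk_right u v))]
    norm_num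
  have hshare : ∀ e f : G.edgeSet, e ≠ f → (∃ v : V, v ∈ (e : Sym2 V) ∧ v ∈ (f : Sym2 V)) →
      (Bᴴ * B) e f ∈ ({1, gamma, gamma ^ 2} : Set ℂ) := by
    rintro e f hef ⟨v, hve, hvf⟩
    rw [mul_apply, Fintype.sum_eq_single v fun w hwv => hterm e f w fun hw => hwv
      (Sym2.eq_of_mem_of_mem_of_ne (Subtype.coe_injective.ne hef) hve hvf hw.1 hw.2),
      mem_powers_gamma_iff, conjTranspose_apply, mul_pow, ← star_pow, hcube e v hve,
      hcube f v hvf, star_one, one_mul]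
  have hdisj : ∀ e f : G.edgeSet, (¬ ∃ v : V, v ∈ (e : Sym2 V) ∧ v ∈ (f : Sym2 V)) →
      (Bᴴ * B) e f = 0 := fun e f h => by
    rw [mul_apply]
    exact Finset.sum_eq_zero fun w _ => hterm e f w fun hw => h ⟨w, hw⟩
  refine ⟨hdiag, fun e f hef => ⟨hshare e f hef, hdisj e f⟩, ?_⟩
  rintro M rfl
  refine ⟨?_, fun e f h => ?_, fun e f h => ?_⟩
  · refine (isHermitian_conjTranspose_mul_self B).sub ?_
    simp [IsHermitian]
  · obtain ⟨hef, hv⟩ := SimpleGraph.lineGraph_adj_iff_exists.1 h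
    rw [Matrix.sub_apply, Matrix.smul_apply, one_apply_ne hef, smul_zero, sub_zero]
    exact hshare e f hef hv
  · by_cases hef : e = f
    · subst hef
      rw [Matrix.sub_apply, Matrix.smul_apply, one_apply_eq, hdiag]
      norm_num
    · have hv := fun hv => h (SimpleGraph.lineGraph_adj_iff_exists.2 ⟨hef, hv⟩)
      rw [Matrix.sub_apply, Matrix.smul_apply, one_apply_ne hef, smul_zero, sub_zero, hdisj e f hv]
end

section
/- Let (G, H) be a mixed graph with G connected (preconnected on a nonempty finite vertex type), and let Q = D + H be its γ-signless Laplacian adjacency matrix. Then Q is singular (det Q = 0) if and only if G is bipartite and every cycle of G has γ-weight 1, i.e. for every closed walk W = v₀ v₁ … v_k = v₀ in G that is a cycle, the product H v₀v₁ · H v₁v₂ ⋯ H v_{k−1}v_k equals 1. -/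
open Matrix Complex BigOperators

/-- The γ-weight of a walk: the product of the entries of `H` along its edges. -/
def walkWeight {V : Type*} {G : SimpleGraph V} (H : Matrix V V ℂ) :
    {u v : V} → G.Walk u v → ℂ
  | _, _, SimpleGraph.Walk.nil => 1
  | _, _, @SimpleGraph.Walk.cons _ _ u x _ _ p => H u x * walkWeight H p

/-- A simple graph is bipartite if its vertices can be split into two parts such that
every edge goes between the parts. -/
def IsBipartite {V : Type*} (G : SimpleGraph V) : Prop :=
  ∃ s : Set V, ∀ ⦃u v : V⦄, G.Adj u v → (u ∈ s ↔ v ∉ s)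

section WalkWeight

variable {V : Type*} {G : SimpleGraph V} {H : Matrix V V ℂ}

theorem gamma_pow_three : gamma ^ 3 = 1 := by
  rw [gamma, ← Complex.exp_nat_mul, ← Complex.exp_two_pi_mul_I]
  congr 1
  push_cast
  ring

theorem pow_three_eq_one_of_mem {z : ℂ} (hz : z ∈ ({1, gamma, gamma ^ 2} : Set ℂ)) :
    z ^ 3 = 1 := by
  rcases hz with rfl | rfl | rfl
  · simp
  · exact gamma_pow_three
  · rw [← pow_mul, mul_comm, pow_mul, gamma_pow_three, one_pow]

theorem Matrix.IsHermitian.apply_mul_apply_eq_one (hH : H.IsHermitian) {u v : V}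
    (h : H u v ^ 3 = 1) : H u v * H v u = 1 := by
  rw [← hH.apply v u, ← starRingEnd_apply, Complex.mul_conj, Complex.normSq_eq_norm_sq,
    Complex.norm_eq_one_of_pow_eq_one h (by norm_num)]
  simp

@[simp]
theorem walkWeight_nil (H : Matrix V V ℂ) (u : V) :
    walkWeight H (SimpleGraph.Walk.nil : G.Walk u u) = 1 := rfl

@[simp]
theorem walkWeight_cons (H : Matrix V V ℂ) {u v w : V} (h : G.Adj u v) (p : G.Walk v w) :
    walkWeight H (SimpleGraph.Walk.cons h p) = H u v * walkWeight H p := rfl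

theorem walkWeight_append (H : Matrix V V ℂ) {u v w : V} (p : G.Walk u v) (q : G.Walk v w) :
    walkWeight H (p.append q) = walkWeight H p * walkWeight H q := by
  induction p with
  | nil => simp
  | cons h p ih => simp [ih, mul_assoc]

theorem walkWeight_pow_three (hcube : ∀ u v, G.Adj u v → H u v ^ 3 = 1) {u v : V}
    (p : G.Walk u v) : walkWeight H p ^ 3 = 1 := by
  induction p with
  | nil => simp
  | cons h p ih => rw [walkWeight_cons, mul_pow, hcube _ _ h, ih, one_mul]

/-- If every cycle has weight `1`, so does every closed walk consisting of an edge followed by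
a path. -/
theorem walkWeight_cons_eq_one_of_isPath (hinv : ∀ u v, G.Adj u v → H u v * H v u = 1)
    (hcyc : ∀ (v : V) (w : G.Walk v v), w.IsCycle → walkWeight H w = 1)
    {u v : V} (h : G.Adj u v) (p : G.Walk v u) (hp : p.IsPath) :
    walkWeight H (SimpleGraph.Walk.cons h p) = 1 := by
  by_cases he : s(u, v) ∈ p.edges
  · cases p with
    | nil => exact absurd rfl h.ne
    | @cons _ y _ h' q =>
      rw [SimpleGraph.Walk.cons_isPath_iff] at hp
      rw [SimpleGraph.Walk.edges_cons, List.mem_cons] at he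
      rcases he with he | he
      · have hy : y = u := by
          rcases Sym2.eq_iff.mp he with ⟨h1, h2⟩ | ⟨h1, h2⟩
          · exact absurd h1 h.ne
          · exact h1.symm
        subst hy
        rw [(SimpleGraph.Walk.isPath_iff_nil.mp hp.1).eq_nil]
        simpa using hinv _ _ h
      · exact absurd (q.snd_mem_support_of_mem_edges he) hp.2
  · exact hcyc _ _ ((SimpleGraph.Walk.cons_isCycle_iff p h).mpr ⟨hp, he⟩)

theorem walkWeight_bypass [DecidableEq V] (hinv : ∀ u v, G.Adj u v → H u v * H v u = 1)
    (hcyc : ∀ (v : V) (w : G.Walk v v), w.IsCycle → walkWeight H w = 1)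
    {u v : V} (p : G.Walk u v) : walkWeight H p.bypass = walkWeight H p := by
  induction p with
  | nil => rfl
  | @cons u v w h p ih =>
    rw [walkWeight_cons, ← ih, SimpleGraph.Walk.bypass]
    split_ifs with hs
    · have hp := p.bypass_isPath.takeUntil hs
      have h1 := walkWeight_cons_eq_one_of_isPath hinv hcyc h _ hp
      conv_rhs => rw [← p.bypass.take_spec hs]
      rw [walkWeight_append, ← mul_assoc, ← walkWeight_cons H h, h1, one_mul]
    · rfl

theorem walkWeight_closed_eq_one [DecidableEq V]
    (hinv : ∀ u v, G.Adj u v → H u v * H v u = 1)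
    (hcyc : ∀ (v : V) (w : G.Walk v v), w.IsCycle → walkWeight H w = 1)
    {u : V} (p : G.Walk u u) : walkWeight H p = 1 := by
  rw [← walkWeight_bypass hinv hcyc p,
    (SimpleGraph.Walk.isPath_iff_nil.mp p.bypass_isPath).eq_nil, walkWeight_nil]

/-- If every cycle has weight `1`, the weight of a walk depends only on its endpoints. -/
theorem walkWeight_eq_walkWeight [DecidableEq V]
    (hinv : ∀ u v, G.Adj u v → H u v * H v u = 1)
    (hcyc : ∀ (v : V) (w : G.Walk v v), w.IsCycle → walkWeight H w = 1)
    {u v : V} (p q : G.Walk u v) : walkWeight H p = walkWeight H q := by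
  have hp := walkWeight_closed_eq_one hinv hcyc (p.append q.reverse)
  have hq := walkWeight_closed_eq_one hinv hcyc (q.append q.reverse)
  rw [walkWeight_append] at hp hq
  exact mul_right_cancel₀ (right_ne_zero_of_mul_eq_one hq) (hp.trans hq.symm)

theorem apply_eq_neg_one_pow_mul_walkWeight {x : V → ℂ}
    (hx : ∀ u v, G.Adj u v → x u + H u v * x v = 0) {u v : V} (p : G.Walk u v) :
    x u = (-1) ^ p.length * walkWeight H p * x v := by
  induction p with
  | nil => simp
  | cons h p ih =>
    rw [eq_neg_of_add_eq_zero_left (hx _ _ h), ih, walkWeight_cons, SimpleGraph.Walk.length_cons]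
    ring

end WalkWeight

section SignlessLaplacian

variable {V : Type*} [Fintype V] [DecidableEq V] {G : SimpleGraph V} [DecidableRel G.Adj]
  {H : Matrix V V ℂ}

theorem signlessLaplacian_mulVec_apply (hnadj : ∀ u v, ¬ G.Adj u v → H u v = 0)
    (x : V → ℂ) (u : V) :
    ((Matrix.diagonal (fun u => (G.degree u : ℂ)) + H) *ᵥ x) u =
      ∑ v, if G.Adj u v then x u + H u v * x v else 0 := by
  have hdeg : (G.degree u : ℂ) * x u = ∑ v, if G.Adj u v then x u else 0 := by
    rw [← Finset.sum_filter, Finset.sum_const, nsmul_eq_mul, ← G.neighborFinset_eq_filter,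
      G.card_neighborFinset_eq_degree]
  rw [Matrix.add_mulVec, Pi.add_apply, Matrix.mulVec_diagonal, hdeg, Matrix.mulVec, dotProduct,
    ← Finset.sum_add_distrib]
  refine Finset.sum_congr rfl fun v _ => ?_
  split_ifs with h
  · rfl
  · simp [hnadj u v h]

/-- The kernel of the signless Laplacian consists of the vectors annihilated edgewise. -/
theorem signlessLaplacian_mulVec_eq_zero_iff (hH : H.IsHermitian)
    (hinv : ∀ u v, G.Adj u v → H u v * H v u = 1)
    (hnadj : ∀ u v, ¬ G.Adj u v → H u v = 0) (x : V → ℂ) :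
    (Matrix.diagonal (fun u => (G.degree u : ℂ)) + H) *ᵥ x = 0 ↔
      ∀ u v, G.Adj u v → x u + H u v * x v = 0 := by
  constructor
  · intro hx
    let e : V → V → ℂ := fun u v => if G.Adj u v then x u + H u v * x v else 0
    have hrow : ∀ u, ∑ v, e u v = 0 := fun u => by
      rw [← signlessLaplacian_mulVec_apply hnadj, hx, Pi.zero_apply]
    have hnorm : ∀ u v, ((‖e u v‖ ^ 2 : ℝ) : ℂ) = star (x u) * e u v + star (x v) * e v u := by
      intro u v
      rw [← Complex.normSq_eq_norm_sq, Complex.normSq_eq_conj_mul_self, starRingEnd_apply]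
      by_cases h : G.Adj u v
      · simp only [e, if_pos h, if_pos h.symm, star_add, star_mul, hH.apply v u]
        linear_combination star (x v) * x v * hinv u v h
      · simp [e, h, mt G.adj_symm h]
    have hsum : ∑ u, ∑ v, ‖e u v‖ ^ 2 = 0 := by
      rw [← Complex.ofReal_inj]
      simp only [Complex.ofReal_sum, hnorm, Finset.sum_add_distrib]
      rw [Finset.sum_comm (f := fun u v => star (x v) * e v u)]
      simp [← Finset.mul_sum, hrow]
    intro u v h
    rw [Finset.sum_eq_zero_iff_of_nonneg fun _ _ => by positivity] at hsum
    have hu := hsum u (Finset.mem_univ u)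
    rw [Finset.sum_eq_zero_iff_of_nonneg fun _ _ => by positivity] at hu
    simpa [e, h] using hu v (Finset.mem_univ v)
  · intro hx
    ext u
    rw [signlessLaplacian_mulVec_apply hnadj]
    refine Finset.sum_eq_zero fun v _ => ?_
    split_ifs with h
    · exact hx u v h
    · rfl

end SignlessLaplacian

/-- For a connected mixed graph, the γ-signless Laplacian `Q = D + H` is singular iff the
underlying graph is bipartite and every cycle has γ-weight `1` (γ-monostore). -/
theorem signless_laplacian_singular_iff {V : Type*} [Fintype V] [DecidableEq V] [Nonempty V]
    (G : SimpleGraph V) [DecidableRel G.Adj] (hconn : G.Preconnected)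
    (H : Matrix V V ℂ) (hH : H.IsHermitian)
    (hadj : ∀ u v, G.Adj u v → H u v ∈ ({1, gamma, gamma ^ 2} : Set ℂ))
    (hnadj : ∀ u v, ¬ G.Adj u v → H u v = 0) :
    (Matrix.diagonal (fun u => (G.degree u : ℂ)) + H).det = 0 ↔
      (IsBipartite G ∧ ∀ (v : V) (w : G.Walk v v), w.IsCycle → walkWeight H w = 1) := by
  have hcube : ∀ u v, G.Adj u v → H u v ^ 3 = 1 := fun u v h =>
    pow_three_eq_one_of_mem (hadj u v h)
  have hinv : ∀ u v, G.Adj u v → H u v * H v u = 1 := fun u v h =>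
    hH.apply_mul_apply_eq_one (hcube u v h)
  rw [← Matrix.exists_mulVec_eq_zero_iff]
  simp only [signlessLaplacian_mulVec_eq_zero_iff hH hinv hnadj]
  constructor
  · rintro ⟨x, hx0, hx⟩
    obtain ⟨r, hr⟩ := Function.ne_iff.mp hx0
    have hne : ∀ v, x v ≠ 0 := fun v hv => by
      obtain ⟨p⟩ := hconn r v
      exact hr (by rw [apply_eq_neg_one_pow_mul_walkWeight hx p, hv, mul_zero, Pi.zero_apply])
    have hwalk : ∀ {u v : V} (p : G.Walk u v), x u ^ 3 = (-1) ^ p.length * x v ^ 3 := by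
      intro u v p
      rw [apply_eq_neg_one_pow_mul_walkWeight hx p, mul_pow, mul_pow,
        walkWeight_pow_three hcube, ← pow_mul, mul_comm p.length, pow_mul]
      norm_num
    refine ⟨⟨{u | x u ^ 3 = x r ^ 3}, fun u v h => ?_⟩, fun v w _ => ?_⟩
    · have huv : x u ^ 3 = -x v ^ 3 := by simpa using hwalk h.toWalk
      obtain ⟨p⟩ := hconn v r
      have hv := hwalk p
      simp only [Set.mem_ofPred_eq, huv]
      rcases neg_one_pow_eq_or ℂ p.length with hp | hp <;> simp [hv, hp, neg_eq_self, hne r]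
    · have h3 : (-1 : ℂ) ^ w.length = 1 :=
        (mul_eq_right₀ (pow_ne_zero 3 (hne v))).mp (hwalk w).symm
      have h1 := apply_eq_neg_one_pow_mul_walkWeight hx w
      rw [h3, one_mul] at h1
      exact (mul_eq_right₀ (hne v)).mp h1.symm
  · rintro ⟨⟨s, hs⟩, hcyc⟩
    classical
    obtain ⟨r⟩ := ‹Nonempty V›
    let p : ∀ u, G.Walk u r := fun u => (hconn u r).some
    refine ⟨fun u => (if u ∈ s then 1 else -1) * walkWeight H (p u), fun h0 => ?_,
      fun u v h => ?_⟩
    · have hr := congrFun h0 r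
      simp only [walkWeight_closed_eq_one hinv hcyc, Pi.zero_apply] at hr
      split_ifs at hr <;> simp at hr
    · have huv : walkWeight H (p u) = H u v * walkWeight H (p v) :=
        walkWeight_eq_walkWeight hinv hcyc (p u) (SimpleGraph.Walk.cons h (p v))
      have hsuv := hs h
      simp only [huv]
      by_cases hv : v ∈ s
      · simp only [hv, not_true_eq_false, iff_false] at hsuv
        simp [hv, hsuv]
      · simp only [hv, not_false_eq_true, iff_true] at hsuv
        simp [hv, hsuv]
end

section
/- Let (G, H) be a mixed graph on n vertices with m edges that contains at least one digon (an edge {u,v} with H u v = 1), and let Q = D + H be its γ-signless Laplacian adjacency matrix with largest eigenvalue λ₁ and smallest eigenvalue λₙ. Then (n/2)·λₙ + 1 ≤ m ≤ (n/2)·λ₁ − 1. -/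
open Matrix Complex BigOperators

section

open scoped ComplexOrder

/-- If `a + b * x` is nonnegative at every eigenvalue `x` of a Hermitian matrix `A`, then
`a • 1 + b • A` is positive semidefinite. -/
theorem Matrix.IsHermitian.posSemidef_smul_one_add_smul {n : Type*} [Fintype n] [DecidableEq n]
    {A : Matrix n n ℂ} (hA : A.IsHermitian) {a b : ℝ} (h : ∀ i, 0 ≤ a + b * hA.eigenvalues i) :
    ((a : ℂ) • (1 : Matrix n n ℂ) + (b : ℂ) • A).PosSemidef := by
  have hd : (diagonal fun i => ((a + b * hA.eigenvalues i : ℝ) : ℂ)).PosSemidef :=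
    PosSemidef.diagonal fun i => Complex.zero_le_real.mpr (h i)
  have hU : (hA.eigenvectorUnitary : Matrix n n ℂ) * (hA.eigenvectorUnitary : Matrix n n ℂ)ᴴ = 1 :=
    Unitary.coe_mul_star_self hA.eigenvectorUnitary
  have hs : A = (hA.eigenvectorUnitary : Matrix n n ℂ) *
      diagonal (fun i => (hA.eigenvalues i : ℂ)) * (hA.eigenvectorUnitary : Matrix n n ℂ)ᴴ :=
    hA.spectral_theorem
  have hdiag : (diagonal fun i => ((a + b * hA.eigenvalues i : ℝ) : ℂ)) =
      (a : ℂ) • (1 : Matrix n n ℂ) + (b : ℂ) • diagonal (fun i => (hA.eigenvalues i : ℂ)) := by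
    ext i j
    by_cases hij : i = j <;> simp [hij]
  have key := hd.mul_mul_conjTranspose_same (hA.eigenvectorUnitary : Matrix n n ℂ)
  rwa [hdiag, mul_add, add_mul, mul_smul_comm, mul_smul_comm, smul_mul_assoc, smul_mul_assoc,
    ← hs, mul_one, hU] at key

/-- In a positive semidefinite matrix, twice the real part of an off-diagonal entry is bounded
in absolute value by the trace. -/
theorem Matrix.PosSemidef.two_mul_abs_re_le_re_trace {n : Type*} [Fintype n] [DecidableEq n]
    {B : Matrix n n ℂ} (hB : B.PosSemidef) {u v : n} (huv : u ≠ v) :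
    2 * |(B u v).re| ≤ B.trace.re := by
  have hquad (s : ℝ) (hs : s * s = 1) :
      0 ≤ (B u u).re + (B v v).re + s * (2 * (B u v).re) := by
    have h := (Complex.le_def.mp
      (hB.dotProduct_mulVec_nonneg (Pi.single u 1 + Pi.single v (s : ℂ)))).1
    have hvu : (B v u).re = (B u v).re := by
      rw [← hB.isHermitian.apply v u]
      simp
    simp [mulVec_add, add_dotProduct, dotProduct_add, hvu] at h
    linear_combination h + (B v v).re * hs
  have hsub : (B u u).re + (B v v).re ≤ B.trace.re := by
    rw [trace, Complex.re_sum, ← Finset.sum_pair (f := fun i => (B i i).re) huv]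
    exact Finset.sum_le_sum_of_subset_of_nonneg (Finset.subset_univ _)
      fun i _ _ => (Complex.le_def.mp hB.diag_nonneg).1
  have h₁ := hquad 1 (by norm_num)
  have h₂ := hquad (-1) (by norm_num)
  rcases abs_cases (B u v).re with h | h <;> linarith [h.1]

end

/-- For a mixed graph on `n` vertices with `m` edges containing at least one digon,
with γ-signless Laplacian `Q = D + H` having largest eigenvalue `λ₁` and smallest
eigenvalue `λₙ`, one has `(n/2)·λₙ + 1 ≤ m ≤ (n/2)·λ₁ − 1`. -/
theorem edge_count_eigenvalue_bounds {V : Type*} [Fintype V] [DecidableEq V] [Nonempty V]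
    (G : SimpleGraph V) [DecidableRel G.Adj]
    (H : Matrix V V ℂ) (hH : H.IsHermitian)
    (hadj : ∀ u v, G.Adj u v → H u v ∈ ({1, gamma, gamma ^ 2} : Set ℂ))
    (hnadj : ∀ u v, ¬ G.Adj u v → H u v = 0)
    (hdigon : ∃ u v, G.Adj u v ∧ H u v = 1)
    (hQ : (Matrix.diagonal (fun u => (G.degree u : ℂ)) + H).IsHermitian) :
    ((Fintype.card V : ℝ) / 2) * (⨅ i, hQ.eigenvalues i) + 1 ≤ (G.edgeFinset.card : ℝ) ∧
      (G.edgeFinset.card : ℝ) ≤ ((Fintype.card V : ℝ) / 2) * (⨆ i, hQ.eigenvalues i) - 1 := by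
  obtain ⟨u, v, huv, h1⟩ := hdigon
  have hsum : ∑ i, (G.degree i : ℝ) = 2 * G.edgeFinset.card := by
    exact_mod_cast G.sum_degrees_eq_twice_card_edges
  have htr : (diagonal (fun u => (G.degree u : ℂ)) + H).trace.re = 2 * G.edgeFinset.card := by
    have hH0 (i : V) : H i i = 0 := hnadj i i (G.loopless.irrefl i)
    simp [trace, hH0, ← hsum]
  have hlow := (hQ.posSemidef_smul_one_add_smul (a := -⨅ i, hQ.eigenvalues i) (b := 1) fun i => by
    linarith [ciInf_le (Set.finite_range hQ.eigenvalues).bddBelow i]).two_mul_abs_re_le_re_trace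
      huv.ne
  have hup := (hQ.posSemidef_smul_one_add_smul (a := ⨆ i, hQ.eigenvalues i) (b := -1) fun i => by
    linarith [le_ciSup (Set.finite_range hQ.eigenvalues).bddAbove i]).two_mul_abs_re_le_re_trace
      huv.ne
  rw [trace_add, trace_smul _ (diagonal _ + H), smul_eq_mul, Complex.add_re, Complex.re_ofReal_mul,
    htr] at hlow hup
  simp [h1, huv.ne] at hlow hup
  constructor <;> linarith
end

section
/- Let (G, H) be a mixed graph on n vertices that contains at least one digon (an edge {u,v} with H u v = 1), and let Q = D + H be its γ-signless Laplacian adjacency matrix with largest eigenvalue λ₁ and smallest eigenvalue λₙ. Then λ₁ − λₙ ≥ 4/n. -/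
open Matrix Complex BigOperators

open scoped ComplexOrder in
open Unitary in
/-- A real upper bound for the eigenvalues of a Hermitian matrix bounds it in the Loewner order. -/
lemma Matrix.IsHermitian.posSemidef_diagonal_sub {n : Type*} [Fintype n] [DecidableEq n]
    {A : Matrix n n ℂ} (hA : A.IsHermitian) {c : ℝ} (hc : ∀ i, hA.eigenvalues i ≤ c) :
    (diagonal (fun _ => (c : ℂ)) - A).PosSemidef := by
  have h : (diagonal (fun i => (c : ℂ) - hA.eigenvalues i)).PosSemidef :=
    posSemidef_diagonal_iff.mpr fun i => by
      rw [← Complex.ofReal_sub]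
      exact Complex.zero_le_real.mpr (sub_nonneg.mpr (hc i))
  convert h.mul_mul_conjTranspose_same (hA.eigenvectorUnitary : Matrix n n ℂ) using 1
  have hU : (hA.eigenvectorUnitary : Matrix n n ℂ) * (hA.eigenvectorUnitary : Matrix n n ℂ)ᴴ = 1 :=
    Unitary.coe_mul_star_self _
  have hs := hA.spectral_theorem
  rw [conjStarAlgAut_apply] at hs
  have hd : diagonal (fun i => (c : ℂ) - hA.eigenvalues i)
      = (c : ℂ) • (1 : Matrix n n ℂ) - diagonal (RCLike.ofReal ∘ hA.eigenvalues) := by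
    rw [smul_one_eq_diagonal, diagonal_sub]
    rfl
  rw [hd, mul_sub, sub_mul, mul_smul_comm, mul_one, smul_mul_assoc, hU, smul_one_eq_diagonal]
  exact congrArg _ hs

open scoped ComplexOrder in
open Unitary in
/-- A real lower bound for the eigenvalues of a Hermitian matrix bounds it in the Loewner order. -/
lemma Matrix.IsHermitian.posSemidef_sub_diagonal {n : Type*} [Fintype n] [DecidableEq n]
    {A : Matrix n n ℂ} (hA : A.IsHermitian) {c : ℝ} (hc : ∀ i, c ≤ hA.eigenvalues i) :
    (A - diagonal (fun _ => (c : ℂ))).PosSemidef := by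
  have h : (diagonal (fun i => (hA.eigenvalues i : ℂ) - c)).PosSemidef :=
    posSemidef_diagonal_iff.mpr fun i => by
      rw [← Complex.ofReal_sub]
      exact Complex.zero_le_real.mpr (sub_nonneg.mpr (hc i))
  convert h.mul_mul_conjTranspose_same (hA.eigenvectorUnitary : Matrix n n ℂ) using 1
  have hU : (hA.eigenvectorUnitary : Matrix n n ℂ) * (hA.eigenvectorUnitary : Matrix n n ℂ)ᴴ = 1 :=
    Unitary.coe_mul_star_self _
  have hs := hA.spectral_theorem
  rw [conjStarAlgAut_apply] at hs
  have hd : diagonal (fun i => (hA.eigenvalues i : ℂ) - c)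
      = diagonal (RCLike.ofReal ∘ hA.eigenvalues) - (c : ℂ) • (1 : Matrix n n ℂ) := by
    rw [smul_one_eq_diagonal, diagonal_sub]
    rfl
  rw [hd, mul_sub, sub_mul, mul_smul_comm, mul_one, smul_mul_assoc, hU, smul_one_eq_diagonal]
  exact congrArg (· - _) hs

open scoped ComplexOrder in
/-- The spread of a Hermitian matrix with an off-diagonal entry equal to `1` is at least `2`. -/
lemma Matrix.IsHermitian.two_le_iSup_sub_iInf_eigenvalues {n : Type*} [Fintype n] [DecidableEq n]
    {A : Matrix n n ℂ} (hA : A.IsHermitian) {u v : n} (huv : u ≠ v) (h : A u v = 1) :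
    2 ≤ (⨆ i, hA.eigenvalues i) - (⨅ i, hA.eigenvalues i) := by
  have hvu : A v u = 1 := by rw [← hA.apply, h, star_one]
  have h₁ := (hA.posSemidef_diagonal_sub fun i =>
    le_ciSup (Set.finite_range hA.eigenvalues).bddAbove i).dotProduct_mulVec_nonneg
      (Pi.single u 1 + Pi.single v 1)
  have h₂ := (hA.posSemidef_sub_diagonal fun i =>
    ciInf_le (Set.finite_range hA.eigenvalues).bddBelow i).dotProduct_mulVec_nonneg
      (Pi.single u 1 - Pi.single v 1)
  replace h₁ := (Complex.le_def.mp h₁).1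
  replace h₂ := (Complex.le_def.mp h₂).1
  simp [mulVec_add, mulVec_sub, add_dotProduct, sub_dotProduct, h, hvu, huv,
    huv.symm] at h₁ h₂
  linarith

/-- For a mixed graph on `n` vertices containing at least one digon, the spread of the
γ-signless Laplacian satisfies `λ₁ − λₙ ≥ 4/n`. -/
theorem signless_laplacian_spread_ge_four_div {V : Type*} [Fintype V] [DecidableEq V] [Nonempty V]
    (G : SimpleGraph V) [DecidableRel G.Adj]
    (H : Matrix V V ℂ) (hH : H.IsHermitian)
    (hadj : ∀ u v, G.Adj u v → H u v ∈ ({1, gamma, gamma ^ 2} : Set ℂ))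
    (hnadj : ∀ u v, ¬ G.Adj u v → H u v = 0)
    (hdigon : ∃ u v, G.Adj u v ∧ H u v = 1)
    (hQ : (Matrix.diagonal (fun u => (G.degree u : ℂ)) + H).IsHermitian) :
    (⨆ i, hQ.eigenvalues i) - (⨅ i, hQ.eigenvalues i) ≥ 4 / (Fintype.card V : ℝ) := by
  obtain ⟨u, v, hu, h1⟩ := hdigon
  have hspread := hQ.two_le_iSup_sub_iInf_eigenvalues hu.ne (by simp [hu.ne, h1])
  have hcard : (2 : ℝ) ≤ Fintype.card V := by
    exact_mod_cast Fintype.one_lt_card_iff.mpr ⟨u, v, hu.ne⟩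
  refine le_trans ?_ hspread
  rw [div_le_iff₀ (by linarith)]
  linarith
end

section
/- Let (G, H) be a mixed graph on n vertices, let k be the number of arcs (edges {u,v} with H u v ≠ 1) and l the number of digons (edges with H u v = 1), and let Q = D + H be its γ-signless Laplacian adjacency matrix with largest eigenvalue λ₁. Then λ₁ ≥ (4l + k)/n. -/
open Matrix Complex BigOperators

open scoped ComplexOrder in
/-- The matrix `c • 1 - A` is positive semidefinite as soon as `c` bounds the spectrum of `A`. -/
theorem Matrix.IsHermitian.posSemidef_smul_one_sub {n : Type*} [Fintype n] [DecidableEq n]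
    {A : Matrix n n ℂ} (hA : A.IsHermitian) {c : ℝ} (hc : ∀ i, hA.eigenvalues i ≤ c) :
    ((c : ℂ) • (1 : Matrix n n ℂ) - A).PosSemidef := by
  set U := hA.eigenvectorUnitary
  have hdiag : (diagonal fun i => ((c - hA.eigenvalues i : ℝ) : ℂ)).PosSemidef :=
    posSemidef_diagonal_iff.2 fun i => by
      exact_mod_cast sub_nonneg.2 (hc i)
  have hU : (U : Matrix n n ℂ) * (U : Matrix n n ℂ)ᴴ = 1 := Unitary.coe_mul_star_self U
  convert hdiag.mul_mul_conjTranspose_same (U : Matrix n n ℂ) using 1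
  have hsplit : (diagonal fun i => ((c - hA.eigenvalues i : ℝ) : ℂ)) =
      (c : ℂ) • (1 : Matrix n n ℂ) - diagonal (RCLike.ofReal ∘ hA.eigenvalues) := by
    ext i j
    by_cases h : i = j <;> simp [h]
  rw [hsplit, mul_sub, sub_mul, mul_smul_comm, mul_one, smul_mul_assoc, hU]
  conv_lhs => rw [hA.spectral_theorem, Unitary.conjStarAlgAut_apply]
  rfl

open scoped ComplexOrder in
/-- The Rayleigh quotient of the all-ones vector bounds the largest eigenvalue from below. -/
theorem Matrix.IsHermitian.sum_re_le_card_mul_iSup_eigenvalues {n : Type*} [Fintype n]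
    [DecidableEq n] {A : Matrix n n ℂ} (hA : A.IsHermitian) :
    ∑ i, ∑ j, (A i j).re ≤ Fintype.card n * ⨆ i, hA.eigenvalues i := by
  have h := (hA.posSemidef_smul_one_sub
    fun i => le_ciSup (Set.finite_range hA.eigenvalues).bddAbove i).re_dotProduct_nonneg
    (fun _ => (1 : ℂ))
  simp only [sub_mulVec, smul_mulVec, one_mulVec, dotProduct_sub, dotProduct_smul, map_sub] at h
  simpa [dotProduct, mulVec, mul_comm] using h

theorem gamma_re : gamma.re = -1 / 2 := by
  have h : (2 * Real.pi * Complex.I / 3 : ℂ) = ((Real.pi - Real.pi / 3 : ℝ) : ℂ) * Complex.I := by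
    push_cast
    ring
  rw [gamma, h, exp_ofReal_mul_I_re, Real.cos_pi_sub, Real.cos_pi_div_three]
  norm_num

theorem gamma_sq_re : (gamma ^ 2).re = -1 / 2 := by
  have h : ((2 : ℕ) * (2 * Real.pi * Complex.I / 3) : ℂ) =
      ((Real.pi / 3 + Real.pi : ℝ) : ℂ) * Complex.I := by
    push_cast
    ring
  rw [gamma, ← Complex.exp_nat_mul, h, exp_ofReal_mul_I_re, Real.cos_add_pi,
    Real.cos_pi_div_three]
  norm_num

/-- For a mixed graph on `n` vertices with `k` arcs and `l` digons, the largest eigenvalue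
of the γ-signless Laplacian satisfies `λ₁ ≥ (4l + k)/n`. Here each unordered digon/arc is
counted via the two ordered pairs it determines. -/
theorem largest_eigenvalue_ge_digon_arc {V : Type*} [Fintype V] [DecidableEq V] [Nonempty V]
    (G : SimpleGraph V) [DecidableRel G.Adj]
    (H : Matrix V V ℂ) (hH : H.IsHermitian)
    (hadj : ∀ u v, G.Adj u v → H u v ∈ ({1, gamma, gamma ^ 2} : Set ℂ))
    (hnadj : ∀ u v, ¬ G.Adj u v → H u v = 0)
    (k l : ℕ)
    (hl : 2 * l = Nat.card {p : V × V // G.Adj p.1 p.2 ∧ H p.1 p.2 = 1})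
    (hk : 2 * k = Nat.card {p : V × V // G.Adj p.1 p.2 ∧ H p.1 p.2 ≠ 1})
    (hQ : (Matrix.diagonal (fun u => (G.degree u : ℂ)) + H).IsHermitian) :
    (⨆ i, hQ.eigenvalues i) ≥ (4 * (l : ℝ) + k) / (Fintype.card V : ℝ) := by
  classical
  have hn : (0 : ℝ) < Fintype.card V := by exact_mod_cast Fintype.card_pos
  rw [ge_iff_le, div_le_iff₀' hn]
  refine le_of_eq_of_le ?_ hQ.sum_re_le_card_mul_iSup_eigenvalues
  have hdeg (u : V) : (G.degree u : ℝ) = ∑ v, if G.Adj u v then 1 else 0 := by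
    simp [← G.card_neighborFinset_eq_degree, G.neighborFinset_eq_filter]
  have hrow (u : V) : ∑ v, ((diagonal (fun u => (G.degree u : ℂ)) + H) u v).re =
      ∑ v, (2 * (if G.Adj u v ∧ H u v = 1 then 1 else 0) +
        (1 / 2) * (if G.Adj u v ∧ H u v ≠ 1 then 1 else 0) : ℝ) := by
    have hdiag : ∑ v, (diagonal (fun u => (G.degree u : ℂ)) u v).re = (G.degree u : ℝ) := by
      simp [diagonal_apply, apply_ite Complex.re]
    simp only [Matrix.add_apply, add_re]
    rw [Finset.sum_add_distrib, hdiag, hdeg, ← Finset.sum_add_distrib]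
    refine Finset.sum_congr rfl fun v _ => ?_
    by_cases h : G.Adj u v
    · by_cases h1 : H u v = 1
      · norm_num [h, h1]
      · have hre : (H u v).re = -1 / 2 := by
          rcases hadj u v h with h' | h' | h'
          · exact absurd h' h1
          · rw [h', gamma_re]
          · rw [h', gamma_sq_re]
        norm_num [h, h1, hre]
    · simp [h, hnadj u v h]
  have hcount (P : V → V → Prop) [∀ u v, Decidable (P u v)] :
      ∑ u, ∑ v, (if P u v then 1 else 0 : ℝ) = (Nat.card {p : V × V // P p.1 p.2} : ℝ) := by
    rw [← Fintype.sum_prod_type' (f := fun u v => (if P u v then 1 else 0 : ℝ))]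
    simp [Fintype.card_subtype]
  simp only [hrow, Finset.sum_add_distrib, ← Finset.mul_sum]
  rw [hcount fun u v => G.Adj u v ∧ H u v = 1, hcount fun u v => G.Adj u v ∧ H u v ≠ 1,
    ← hl, ← hk]
  push_cast
  ring
end

section
/- (Cassels' inequality, used by the paper.) Let a, b : Fin n → ℝ be sequences of positive reals and c : Fin n → ℝ a sequence of nonnegative reals, and suppose there are real numbers 0 < m ≤ M such that m ≤ a k / b k ≤ M for all k. Then (Σₖ cₖ·aₖ²)·(Σₖ cₖ·bₖ²) ≤ ((M + m)² / (4·M·m)) · (Σₖ cₖ·aₖ·bₖ)². -/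
open BigOperators

/-- Cassels' inequality: if `m ≤ aₖ/bₖ ≤ M` for positive sequences `a, b` and `c` is a
nonnegative sequence, then
`(Σ cₖ aₖ²)(Σ cₖ bₖ²) ≤ ((M+m)²/(4Mm)) (Σ cₖ aₖ bₖ)²`. -/
theorem cassels_inequality {n : ℕ} (a b c : Fin n → ℝ)
    (ha : ∀ k, 0 < a k) (hb : ∀ k, 0 < b k) (hc : ∀ k, 0 ≤ c k)
    (m M : ℝ) (hm : 0 < m) (hmM : m ≤ M)
    (hbound : ∀ k, m ≤ a k / b k ∧ a k / b k ≤ M) :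
    (∑ k, c k * a k ^ 2) * (∑ k, c k * b k ^ 2) ≤
      ((M + m) ^ 2 / (4 * M * m)) * (∑ k, c k * a k * b k) ^ 2 := by
  have hM : 0 < M := hm.trans_le hmM
  have hterm : ∀ k, c k * a k ^ 2 + M * m * (c k * b k ^ 2) ≤ (M + m) * (c k * a k * b k) := by
    intro k
    have hlower : m * b k ≤ a k := (le_div_iff₀ (hb k)).1 (hbound k).1
    have hupper : a k ≤ M * b k := (div_le_iff₀ (hb k)).1 (hbound k).2
    have hprod := mul_nonneg (hc k) (mul_nonneg (sub_nonneg.2 hlower) (sub_nonneg.2 hupper))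
    linarith
  have hsum : (∑ k, c k * a k ^ 2) + M * m * (∑ k, c k * b k ^ 2) ≤
      (M + m) * ∑ k, c k * a k * b k := by
    simpa only [Finset.sum_add_distrib, ← Finset.mul_sum] using
      Finset.sum_le_sum fun k (_ : k ∈ Finset.univ) => hterm k
  have hA : 0 ≤ ∑ k, c k * a k ^ 2 :=
    Finset.sum_nonneg fun k _ => mul_nonneg (hc k) (sq_nonneg _)
  have hB : 0 ≤ ∑ k, c k * b k ^ 2 :=
    Finset.sum_nonneg fun k _ => mul_nonneg (hc k) (sq_nonneg _)
  have hsq := pow_le_pow_left₀ (by positivity) hsum 2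
  rw [div_mul_eq_mul_div, le_div_iff₀ (by positivity)]
  linarith [sq_nonneg ((∑ k, c k * a k ^ 2) - M * m * ∑ k, c k * b k ^ 2)]
end
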